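/- Let A ⊆ ℕ be an infinite set and for each N let A_N denote the set of its N smallest elements. There exists a strictly increasing sequence of natural numbers (N_t) along which A has doubly metric Poissonian pair correlations if and only if liminf_{N→∞} N^{-3}·E(A_N) = 0. -/

import Mathlib

open MeasureTheory Filter Set

noncomputable section

/-- The torus `𝕋 = ℝ/ℤ`, equipped with its Haar (Lebesgue) probability measure `volume`. -/
abbrev 𝕋 := UnitAddCircle

/-- The increasing enumeration (0-indexed) of a set `A ⊆ ℕ`; for infinite `A`,
`enum A 0 < enum A 1 < ⋯` lists the elements of `A` in increasing order. -/
noncomputable def enum (A : Set ℕ) (n : ℕ) : ℕ := Nat.nth (· ∈ A) n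

/-- `A_N`: the set of the `N` smallest elements of `A` (for `A` infinite). -/
noncomputable def firstN (A : Set ℕ) (N : ℕ) : Finset ℕ :=
  (Finset.range N).image (enum A)

/-- Additive energy `E(A) = #{(a,b,c,d) ∈ A⁴ : a + b = c + d}` of a finite set `A ⊆ ℕ`. -/
def addE (A : Finset ℕ) : ℕ :=
  (((A ×ˢ A) ×ˢ (A ×ˢ A)).filter (fun q => q.1.1 + q.1.2 = q.2.1 + q.2.2)).card

/-- The inhomogeneous pair correlation function
`F(γ, s, N, x) = (1/N) · #{(i,j) ∈ [N]×[N] : i ≠ j, ‖x_i − x_j − γ‖ ≤ s/N}`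
of a sequence `x` of points of `𝕋` (indices `0, …, N-1` playing the role of `[N]`). -/
noncomputable def Fseq (γ : 𝕋) (s : ℝ) (N : ℕ) (x : ℕ → 𝕋) : ℝ :=
  (Set.ncard {ij : ℕ × ℕ | ij.1 < N ∧ ij.2 < N ∧ ij.1 ≠ ij.2 ∧
      ‖x ij.1 - x ij.2 - γ‖ ≤ s / N} : ℝ) / N

/-- `F(α, γ, s, N, 𝒜)`: the pair correlation function of the points `a_n α ∈ 𝕋`,
where `(a_n)` is the increasing enumeration of `A ⊆ ℕ`. -/
noncomputable def Fpc (α γ : 𝕋) (s : ℝ) (N : ℕ) (A : Set ℕ) : ℝ :=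
  Fseq γ s N (fun n => (enum A n) • α)

/-- `A ⊆ ℕ` has doubly metric Poissonian pair correlations along the sequence `Nt`:
for Lebesgue-a.e. `(α, γ) ∈ 𝕋²` and every `s > 0`, `F(α, γ, s, N_t, 𝒜) → 2s`. -/
def DMPPCAlong (A : Set ℕ) (Nt : ℕ → ℕ) : Prop :=
  ∀ᵐ p : 𝕋 × 𝕋, ∀ s : ℝ, 0 < s →
    Tendsto (fun t => Fpc p.1 p.2 s (Nt t) A) atTop (nhds (2 * s))

/-- `A ⊆ ℕ` has doubly metric Poissonian pair correlations. -/
def DMPPC (A : Set ℕ) : Prop := DMPPCAlong A id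

/-- The strip of all `(α, γ)` with `‖dα - γ‖ ≤ ρ`. -/
def strip (ρ : ℝ) (d : ℤ) : Set (𝕋 × 𝕋) := {p | ‖d • p.1 - p.2‖ ≤ ρ}

lemma measurableSet_strip (ρ : ℝ) (d : ℤ) : MeasurableSet (strip ρ d) := by
  have h : Continuous fun p : 𝕋 × 𝕋 => ‖d • p.1 - p.2‖ := by fun_prop
  exact (isClosed_le h continuous_const).measurableSet

instance : IsProbabilityMeasure (volume : Measure (𝕋 × 𝕋)) := by
  refine ⟨?_⟩
  rw [Measure.volume_eq_prod, ← univ_prod_univ, Measure.prod_prod, UnitAddCircle.measure_univ,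
    one_mul]

lemma volume_real_closedBall_zero {ρ : ℝ} (hρ : 0 ≤ ρ) :
    volume.real (Metric.closedBall (0 : 𝕋) ρ) = min 1 (2 * ρ) := by
  rw [measureReal_def, AddCircle.volume_closedBall, ENNReal.toReal_ofReal]
  positivity

/-- For `d ≠ e` the endomorphism `(α, γ) ↦ (dα - γ, eα - γ)` of the torus preserves the measure. -/
lemma measurePreserving_zsmul_sub {d e : ℤ} (h : d ≠ e) :
    MeasurePreserving (fun p : 𝕋 × 𝕋 => (d • p.1 - p.2, e • p.1 - p.2)) := by
  let φ : 𝕋 × 𝕋 →+ 𝕋 × 𝕋 :=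
    { toFun := fun p => (d • p.1 - p.2, e • p.1 - p.2)
      map_zero' := by simp
      map_add' := fun p q => by
        ext <;> simp only [Prod.fst_add, Prod.snd_add, zsmul_add] <;> abel }
  have hc : Continuous φ := by
    change Continuous fun p : 𝕋 × 𝕋 => (d • p.1 - p.2, e • p.1 - p.2)
    fun_prop
  have : (volume : Measure (𝕋 × 𝕋)).IsAddHaarMeasure := by
    rw [Measure.volume_eq_prod]
    infer_instance
  refine AddMonoidHom.measurePreserving (f := φ) hc ?_ (by simp)
  rintro ⟨u, v⟩
  have hk : ((e - d : ℤ) : ℝ) ≠ 0 := by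
    exact_mod_cast sub_ne_zero.2 h.symm
  obtain ⟨α, hα⟩ : ∃ α : 𝕋, (e - d) • α = v - u := by
    obtain ⟨x, hx⟩ := QuotientAddGroup.mk_surjective (v - u)
    refine ⟨((x / ((e - d : ℤ) : ℝ) : ℝ) : 𝕋), ?_⟩
    rw [← AddCircle.coe_zsmul, zsmul_eq_mul, mul_div_cancel₀ _ hk]
    exact hx
  refine ⟨(α, d • α - u), Prod.ext ?_ ?_⟩
  · change d • α - (d • α - u) = u
    abel
  · change e • α - (d • α - u) = v
    rw [sub_zsmul, ← sub_eq_add_neg] at hα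
    rw [← sub_add, hα]
    abel

lemma measureReal_strip_inter {ρ : ℝ} (hρ : 0 ≤ ρ) {d e : ℤ} (h : d ≠ e) :
    volume.real (strip ρ d ∩ strip ρ e) = min 1 (2 * ρ) ^ 2 := by
  have hpre : strip ρ d ∩ strip ρ e = (fun p : 𝕋 × 𝕋 => (d • p.1 - p.2, e • p.1 - p.2)) ⁻¹'
      (Metric.closedBall 0 ρ ×ˢ Metric.closedBall 0 ρ) := by
    ext p
    simp [strip]
  rw [hpre, (measurePreserving_zsmul_sub h).measureReal_preimage
    (Metric.isClosed_closedBall.measurableSet.prod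
      Metric.isClosed_closedBall.measurableSet).nullMeasurableSet,
    Measure.volume_eq_prod, measureReal_prod_prod, volume_real_closedBall_zero hρ, sq]

lemma measureReal_strip {ρ : ℝ} (hρ : 0 ≤ ρ) (d : ℤ) :
    volume.real (strip ρ d) = min 1 (2 * ρ) := by
  have hpre : strip ρ d = (fun p : 𝕋 × 𝕋 => (d • p.1 - p.2, (d + 1) • p.1 - p.2)) ⁻¹'
      (Metric.closedBall 0 ρ ×ˢ univ) := by
    ext p
    simp [strip]
  rw [hpre, (measurePreserving_zsmul_sub (by lia : d ≠ d + 1)).measureReal_preimage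
    (Metric.isClosed_closedBall.measurableSet.prod MeasurableSet.univ).nullMeasurableSet,
    Measure.volume_eq_prod, measureReal_prod_prod, volume_real_closedBall_zero hρ,
    measureReal_def, UnitAddCircle.measure_univ, ENNReal.toReal_one, mul_one]

/-- The number of indices `i ∈ I` for which the point lies in the strip of `f i`. -/
def stripCount {ι : Type*} (ρ : ℝ) (I : Finset ι) (f : ι → ℤ) (p : 𝕋 × 𝕋) : ℝ :=
  ∑ i ∈ I, (strip ρ (f i)).indicator 1 p

/-- The number of pairs of indices in `I` on which `f` takes the same value. -/
def collisions {ι : Type*} (I : Finset ι) (f : ι → ℤ) : ℕ :=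
  ((I ×ˢ I).filter fun x => f x.1 = f x.2).card

lemma integrable_indicator_strip (ρ : ℝ) (d : ℤ) :
    Integrable ((strip ρ d).indicator (1 : 𝕋 × 𝕋 → ℝ)) :=
  (integrable_const (1 : ℝ)).indicator (measurableSet_strip ρ d)

lemma integral_indicator_strip {ρ : ℝ} (hρ : 0 ≤ ρ) (d : ℤ) :
    ∫ p, (strip ρ d).indicator (1 : 𝕋 × 𝕋 → ℝ) p = min 1 (2 * ρ) := by
  rw [integral_indicator_one (measurableSet_strip ρ d), measureReal_strip hρ]

lemma integrable_indicator_strip_mul (ρ : ℝ) (d e : ℤ) :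
    Integrable fun p => (strip ρ d).indicator (1 : 𝕋 × 𝕋 → ℝ) p *
      (strip ρ e).indicator (1 : 𝕋 × 𝕋 → ℝ) p := by
  have h := (integrable_const (μ := (volume : Measure (𝕋 × 𝕋))) (1 : ℝ)).indicator
    ((measurableSet_strip ρ d).inter (measurableSet_strip ρ e))
  refine h.congr (Eventually.of_forall fun p => ?_)
  exact congrFun (inter_indicator_one (M₀ := ℝ) (s := strip ρ d) (t := strip ρ e)) p

lemma integral_indicator_strip_mul {ρ : ℝ} (hρ : 0 ≤ ρ) (d e : ℤ) :
    ∫ p, (strip ρ d).indicator (1 : 𝕋 × 𝕋 → ℝ) p * (strip ρ e).indicator (1 : 𝕋 × 𝕋 → ℝ) p =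
      if d = e then min 1 (2 * ρ) else min 1 (2 * ρ) ^ 2 := by
  have h : (fun p => (strip ρ d).indicator (1 : 𝕋 × 𝕋 → ℝ) p *
      (strip ρ e).indicator (1 : 𝕋 × 𝕋 → ℝ) p) = (strip ρ d ∩ strip ρ e).indicator 1 :=
    (inter_indicator_one (M₀ := ℝ) (s := strip ρ d) (t := strip ρ e)).symm
  rw [h, integral_indicator_one ((measurableSet_strip ρ d).inter (measurableSet_strip ρ e))]
  split_ifs with hde
  · rw [hde, inter_self, measureReal_strip hρ]
  · exact measureReal_strip_inter hρ hde

section Moments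

variable {ι : Type*} {ρ : ℝ} (I : Finset ι) (f : ι → ℤ)

lemma measurable_stripCount (ρ : ℝ) : Measurable (stripCount ρ I f) := by
  unfold stripCount
  exact Finset.measurable_fun_sum _ fun i _ =>
    measurable_one.indicator (measurableSet_strip ρ (f i))

lemma integrable_stripCount (ρ : ℝ) : Integrable (stripCount ρ I f) :=
  integrable_finsetSum _ fun i _ => integrable_indicator_strip ρ (f i)

lemma integral_stripCount (hρ : 0 ≤ ρ) :
    ∫ p, stripCount ρ I f p = I.card * min 1 (2 * ρ) := by
  unfold stripCount
  rw [integral_finsetSum _ fun i _ => integrable_indicator_strip ρ (f i)]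
  simp [integral_indicator_strip hρ]

lemma stripCount_sq (p : 𝕋 × 𝕋) :
    stripCount ρ I f p ^ 2 = ∑ i ∈ I, ∑ j ∈ I,
      (strip ρ (f i)).indicator (1 : 𝕋 × 𝕋 → ℝ) p *
        (strip ρ (f j)).indicator (1 : 𝕋 × 𝕋 → ℝ) p := by
  rw [sq, stripCount, Finset.sum_mul_sum]

lemma integrable_stripCount_sq (ρ : ℝ) : Integrable fun p => stripCount ρ I f p ^ 2 := by
  simp_rw [stripCount_sq]
  exact integrable_finsetSum _ fun i _ => integrable_finsetSum _ fun j _ =>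
    integrable_indicator_strip_mul ρ (f i) (f j)

lemma integral_stripCount_sq (hρ : 0 ≤ ρ) :
    ∫ p, stripCount ρ I f p ^ 2 = (I.card * min 1 (2 * ρ)) ^ 2 +
      collisions I f * (min 1 (2 * ρ) - min 1 (2 * ρ) ^ 2) := by
  simp_rw [stripCount_sq]
  rw [integral_finsetSum _ fun i _ => integrable_finsetSum _ fun j _ =>
    integrable_indicator_strip_mul ρ (f i) (f j)]
  simp_rw [integral_finsetSum I fun j _ => integrable_indicator_strip_mul ρ (f _) (f j),
    integral_indicator_strip_mul hρ]
  generalize min 1 (2 * ρ) = q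
  have h : ∀ i j, (if f i = f j then q else q ^ 2) =
      q ^ 2 + (if f i = f j then 1 else 0) * (q - q ^ 2) := by
    intro i j
    split_ifs <;> ring
  simp_rw [h, Finset.sum_add_distrib, ← Finset.sum_mul, ← Finset.sum_product']
  simp [collisions]
  ring

lemma integral_stripCount_sub_mean_sq (hρ : 0 ≤ ρ) :
    ∫ p, (stripCount ρ I f p - I.card * min 1 (2 * ρ)) ^ 2 =
      collisions I f * (min 1 (2 * ρ) - min 1 (2 * ρ) ^ 2) := by
  have h : ∀ p, (stripCount ρ I f p - I.card * min 1 (2 * ρ)) ^ 2 =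
      stripCount ρ I f p ^ 2 - 2 * (I.card * min 1 (2 * ρ)) * stripCount ρ I f p +
        (I.card * min 1 (2 * ρ)) ^ 2 := fun p => by ring
  simp_rw [h]
  have hsub : Integrable fun p => stripCount ρ I f p ^ 2 -
      2 * (I.card * min 1 (2 * ρ)) * stripCount ρ I f p :=
    (integrable_stripCount_sq I f ρ).sub ((integrable_stripCount I f ρ).const_mul _)
  rw [integral_add hsub (integrable_const _),
    integral_sub (integrable_stripCount_sq I f ρ) ((integrable_stripCount I f ρ).const_mul _),
    integral_const_mul, integral_stripCount I f hρ, integral_stripCount_sq I f hρ]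
  simp
  ring

end Moments

/-- Second moment bound: the union of the strips of distinct slopes is not small. -/
lemma measureReal_stripCount_ne_zero {ρ : ℝ} (hρ : 0 ≤ ρ) (D : Finset ℤ) :
    (D.card * min 1 (2 * ρ)) / (1 + D.card * min 1 (2 * ρ)) ≤
      volume.real {p | stripCount ρ D id p ≠ 0} := by
  have hms : MeasurableSet {p | stripCount ρ D id p ≠ 0} :=
    (measurable_stripCount D id ρ) (measurableSet_singleton 0).compl
  have hcol : collisions D id = D.card := by
    have : (D ×ˢ D).filter (fun x => id x.1 = id x.2) = D.diag := by
      ext ⟨x, y⟩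
      simp only [Finset.mem_filter, Finset.mem_product, Finset.mem_diag, id]
      grind
    rw [collisions, this, Finset.diag_card]
  set m : ℝ := D.card * min 1 (2 * ρ) with hm
  have hm0 : 0 ≤ m := by positivity
  set θ : ℝ := 1 / (1 + m) with hθ
  have hint : ∫ p, (2 * θ * stripCount ρ D id p - θ ^ 2 * stripCount ρ D id p ^ 2) ≤
      ∫ p, ({p | stripCount ρ D id p ≠ 0}.indicator (1 : 𝕋 × 𝕋 → ℝ) p) := by
    refine integral_mono (((integrable_stripCount D id ρ).const_mul _).sub
      ((integrable_stripCount_sq D id ρ).const_mul _))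
      ((integrable_const (1 : ℝ)).indicator hms) fun p => ?_
    by_cases hp : stripCount ρ D id p = 0
    · simp [hp]
    · have : p ∈ {p | stripCount ρ D id p ≠ 0} := hp
      simp only [indicator_of_mem this, Pi.one_apply]
      nlinarith [sq_nonneg (1 - θ * stripCount ρ D id p)]
  rw [integral_indicator_one hms, integral_sub ((integrable_stripCount D id ρ).const_mul _)
    ((integrable_stripCount_sq D id ρ).const_mul _), integral_const_mul, integral_const_mul,
    integral_stripCount D id hρ, integral_stripCount_sq D id hρ, hcol, ← hm] at hint
  refine le_trans ?_ hint
  have h1 : (D.card : ℝ) * (min 1 (2 * ρ) - min 1 (2 * ρ) ^ 2) ≤ m := by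
    rw [hm]
    gcongr
    nlinarith [sq_nonneg (min 1 (2 * ρ))]
  have h2 : θ * (1 + m) = 1 := by rw [hθ]; field_simp
  have h3 : m / (1 + m) = 2 * θ * m - θ ^ 2 * (m ^ 2 + m) := by
    rw [hθ]; field_simp; ring
  rw [h3]
  gcongr

/-- The difference of the elements of `A` with the given two indices. -/
def enumDiff (A : Set ℕ) (x : ℕ × ℕ) : ℤ := (enum A x.1 : ℤ) - enum A x.2

lemma enum_injective {A : Set ℕ} (hA : A.Infinite) : Function.Injective (enum A) :=
  (Nat.nth_strictMono hA).injective

lemma Fpc_eq_stripCount (A : Set ℕ) (p : 𝕋 × 𝕋) (s : ℝ) (N : ℕ) :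
    Fpc p.1 p.2 s N A = stripCount (s / N) (Finset.range N).offDiag (enumDiff A) p / N := by
  classical
  have hset : {ij : ℕ × ℕ | ij.1 < N ∧ ij.2 < N ∧ ij.1 ≠ ij.2 ∧
      ‖enum A ij.1 • p.1 - enum A ij.2 • p.1 - p.2‖ ≤ s / N} =
      ((Finset.range N).offDiag.filter fun x => p ∈ strip (s / N) (enumDiff A x) : Finset _) := by
    ext x
    simp [strip, enumDiff, sub_zsmul, and_assoc, ← sub_eq_add_neg]
  rw [Fpc, Fseq, hset, Set.ncard_coe_finset, stripCount]
  simp [Set.indicator_apply]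

lemma collisions_le_addE {A : Set ℕ} (hA : A.Infinite) (N : ℕ) :
    collisions (Finset.range N).offDiag (enumDiff A) ≤ addE (firstN A N) := by
  refine Finset.card_le_card_of_injOn (fun q : (ℕ × ℕ) × (ℕ × ℕ) =>
    ((enum A q.1.1, enum A q.2.2), (enum A q.2.1, enum A q.1.2))) ?_ ?_
  · rintro ⟨⟨i, j⟩, ⟨k, l⟩⟩ h
    rw [Finset.mem_coe, Finset.mem_filter] at h
    simp only [Finset.mem_product, Finset.mem_offDiag, Finset.mem_range, enumDiff] at h
    rw [Finset.mem_coe, Finset.mem_filter]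
    simp only [firstN, Finset.mem_product]
    refine ⟨⟨⟨Finset.mem_image_of_mem _ ?_, Finset.mem_image_of_mem _ ?_⟩,
      ⟨Finset.mem_image_of_mem _ ?_, Finset.mem_image_of_mem _ ?_⟩⟩, by lia⟩ <;>
    simp only [Finset.mem_range] <;> lia
  · rintro ⟨⟨i, j⟩, ⟨k, l⟩⟩ - ⟨⟨i', j'⟩, ⟨k', l'⟩⟩ - h
    simp only [Prod.mk.injEq, (enum_injective hA).eq_iff] at h ⊢
    tauto

lemma addE_le_collisions_add {A : Set ℕ} (hA : A.Infinite) (N : ℕ) :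
    addE (firstN A N) ≤ collisions (Finset.range N).offDiag (enumDiff A) + N ^ 2 := by
  let C := ((Finset.range N).offDiag ×ˢ (Finset.range N).offDiag).filter
    fun x => enumDiff A x.1 = enumDiff A x.2
  let T := (Finset.range N ×ˢ Finset.range N).image fun x => ((x.1, x.1), (x.2, x.2))
  have hT : T.card ≤ N ^ 2 := Finset.card_image_le.trans (by simp [sq])
  have hsub : (((firstN A N ×ˢ firstN A N) ×ˢ (firstN A N ×ˢ firstN A N)).filter
      (fun q => q.1.1 + q.1.2 = q.2.1 + q.2.2)) ⊆
      (C ∪ T).image (fun q : (ℕ × ℕ) × (ℕ × ℕ) =>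
        ((enum A q.1.1, enum A q.2.2), (enum A q.2.1, enum A q.1.2))) := by
    rintro ⟨⟨a, b⟩, ⟨c, d⟩⟩ h
    simp only [firstN, Finset.mem_filter, Finset.mem_product, Finset.mem_image,
      Finset.mem_range] at h
    obtain ⟨⟨⟨⟨i, hi, rfl⟩, ⟨l, hl, rfl⟩⟩, ⟨⟨k, hk, rfl⟩, ⟨j, hj, rfl⟩⟩⟩, he⟩ := h
    refine Finset.mem_image.2 ⟨((i, j), (k, l)), ?_, rfl⟩
    by_cases hij : i = j
    · subst hij
      have hkl : l = k := enum_injective hA (by lia)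
      subst hkl
      exact Finset.mem_union_right _ (Finset.mem_image.2 ⟨(i, l), by simp [hi, hl], rfl⟩)
    · have hkl : k ≠ l := by
        rintro rfl
        exact hij (enum_injective hA (by lia))
      refine Finset.mem_union_left _ ?_
      rw [Finset.mem_filter]
      simp only [Finset.mem_product, Finset.mem_offDiag, Finset.mem_range, enumDiff]
      exact ⟨⟨⟨hi, hj, hij⟩, hk, hl, hkl⟩, by lia⟩
  calc addE (firstN A N) ≤ _ := Finset.card_le_card hsub
    _ ≤ (C ∪ T).card := Finset.card_image_le
    _ ≤ C.card + T.card := Finset.card_union_le _ _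
    _ ≤ _ := by gcongr; exact le_rfl

/-- The number of pairs of distinct indices below `N` representing the difference `d`. -/
def diffCount (A : Set ℕ) (N : ℕ) (d : ℤ) : ℕ :=
  ((Finset.range N).offDiag.filter fun x => enumDiff A x = d).card

lemma diffCount_le {A : Set ℕ} (hA : A.Infinite) (N : ℕ) (d : ℤ) : diffCount A N d ≤ N := by
  refine (Finset.card_le_card_of_injOn (t := Finset.range N) Prod.fst ?_ ?_).trans
    (Finset.card_range N).le
  · intro x hx
    rw [Finset.mem_coe, Finset.mem_filter, Finset.mem_offDiag] at hx
    exact hx.1.1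
  · rintro ⟨i, j⟩ hx ⟨i', j'⟩ hy (rfl : i = i')
    rw [Finset.mem_coe, Finset.mem_filter] at hx hy
    simp only [enumDiff] at hx hy
    exact Prod.ext rfl (enum_injective hA (by lia))

lemma collisions_eq_sum_diffCount (A : Set ℕ) (N : ℕ) :
    collisions (Finset.range N).offDiag (enumDiff A) =
      ∑ x ∈ (Finset.range N).offDiag, diffCount A N (enumDiff A x) := by
  simp only [collisions, diffCount, Finset.card_filter, Finset.sum_product]
  simp only [eq_comm]

/-- The differences of distinct elements of `A_N` having at least `cN` representations. -/
def popularDiffs (A : Set ℕ) (N : ℕ) (c : ℝ) : Finset ℤ := by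
  classical
  exact ((Finset.range N).offDiag.image (enumDiff A)).filter fun d => c * N ≤ diffCount A N d

lemma le_card_popularDiffs {A : Set ℕ} (hA : A.Infinite) {N : ℕ} (hN : 0 < N) {c : ℝ}
    (hc : 0 < c) (hcN : 2 ≤ c * N) (hE : c * (N : ℝ) ^ 3 ≤ addE (firstN A N)) :
    c / 4 * N ≤ (popularDiffs A N (c / 4)).card := by
  classical
  set P := (Finset.range N).offDiag with hP
  have hN' : (0 : ℝ) < N := by exact_mod_cast hN
  have hE' : (addE (firstN A N) : ℝ) ≤ collisions P (enumDiff A) + (N : ℝ) ^ 2 := by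
    exact_mod_cast addE_le_collisions_add hA N
  have hPc : (P.card : ℝ) ≤ (N : ℝ) ^ 2 := by
    rw [hP, Finset.offDiag_card]
    exact_mod_cast (Nat.sub_le _ _).trans (by simp [sq])
  set R := P.filter fun x => c / 4 * N ≤ diffCount A N (enumDiff A x) with hR
  have hsum : (collisions P (enumDiff A) : ℝ) ≤ P.card * (c / 4 * N) + R.card * N := by
    rw [collisions_eq_sum_diffCount, hR, Finset.card_filter]
    push_cast
    rw [Finset.sum_mul, ← nsmul_eq_mul, ← Finset.sum_const, ← Finset.sum_add_distrib]
    refine Finset.sum_le_sum fun x _ => ?_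
    have := diffCount_le hA N (enumDiff A x)
    have : (diffCount A N (enumDiff A x) : ℝ) ≤ N := by exact_mod_cast this
    have : 0 ≤ c / 4 * N := by positivity
    split_ifs with h
    · linarith
    · linarith
  have hRD : (R.card : ℝ) ≤ (popularDiffs A N (c / 4)).card * N := by
    have : R.card ≤ N * (popularDiffs A N (c / 4)).card := by
      refine Finset.card_le_mul_card_image_of_maps_to (f := enumDiff A) ?_ N ?_
      · intro x hx
        rw [hR, Finset.mem_filter] at hx
        simp only [popularDiffs, Finset.mem_filter]
        exact ⟨Finset.mem_image_of_mem _ hx.1, hx.2⟩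
      · intro d _
        refine (Finset.card_le_card ?_).trans (diffCount_le hA N d)
        exact Finset.filter_subset_filter _ (Finset.filter_subset _ _)
    rw [mul_comm]
    exact_mod_cast this
  have h1 : (P.card : ℝ) * (c / 4 * N) ≤ (N : ℝ) ^ 2 * (c / 4 * N) := by gcongr
  have h2 : (R.card : ℝ) * N ≤ (popularDiffs A N (c / 4)).card * N * N := by gcongr
  have h3 : 2 * (N : ℝ) ^ 2 ≤ c * N * (N : ℝ) ^ 2 := by gcongr
  have h4 : c / 4 * N * (N : ℝ) ^ 2 ≤ (popularDiffs A N (c / 4)).card * (N : ℝ) ^ 2 := by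
    nlinarith
  exact le_of_mul_le_mul_right h4 (by positivity)

lemma le_Fpc_of_stripCount_ne_zero {A : Set ℕ} {N : ℕ} (hN : 0 < N) {c s : ℝ} {p : 𝕋 × 𝕋}
    (h : stripCount (s / N) (popularDiffs A N c) id p ≠ 0) : c ≤ Fpc p.1 p.2 s N A := by
  classical
  obtain ⟨d, hd, hdp⟩ := Finset.exists_ne_zero_of_sum_ne_zero h
  have hdp : p ∈ strip (s / N) d := by
    by_contra hcon
    exact hdp (indicator_of_notMem hcon _)
  simp only [popularDiffs, Finset.mem_filter] at hd
  have hN' : (0 : ℝ) < N := by exact_mod_cast hN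
  rw [Fpc_eq_stripCount, le_div_iff₀ hN']
  refine hd.2.trans ?_
  rw [diffCount, Finset.card_filter, stripCount]
  push_cast
  refine Finset.sum_le_sum fun x _ => ?_
  split_ifs with hx
  · rw [hx, indicator_of_mem hdp, Pi.one_apply]
  · exact indicator_nonneg (fun _ _ => zero_le_one) p

/-- Along a sequence with large additive energy the pair correlations are not Poissonian. -/
lemma not_DMPPCAlong_of_le_addE {A : Set ℕ} (hA : A.Infinite) {Nt : ℕ → ℕ}
    (hNt : Tendsto Nt atTop atTop) {c : ℝ} (hc : 0 < c)
    (hE : ∀ᶠ t in atTop, c * (Nt t : ℝ) ^ 3 ≤ addE (firstN A (Nt t))) :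
    ¬ DMPPCAlong A Nt := by
  intro h
  set s := c / 16 with hs
  have hs0 : 0 < s := by positivity
  let X : ℕ → 𝕋 × 𝕋 → ℝ := fun t =>
    stripCount (s / Nt t) (popularDiffs A (Nt t) (c / 4)) id
  have hms : ∀ t, MeasurableSet {p | X t p ≠ 0} := fun t =>
    (measurable_stripCount _ id _) (measurableSet_singleton 0).compl
  have hreal : Tendsto (fun t => (Nt t : ℝ)) atTop atTop :=
    tendsto_natCast_atTop_atTop.comp hNt
  have hlim : Tendsto (fun t => ∫ p, {p | X t p ≠ 0}.indicator (1 : 𝕋 × 𝕋 → ℝ) p) atTop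
      (nhds (∫ _ : 𝕋 × 𝕋, (0 : ℝ))) := by
    refine tendsto_integral_of_dominated_convergence (fun _ => 1)
      (fun t => (measurable_one.indicator (hms t)).aestronglyMeasurable) (integrable_const _)
      (fun t => Eventually.of_forall fun p => ?_) ?_
    · by_cases hp : X t p = 0 <;> simp [hp]
    · filter_upwards [h] with p hp
      refine tendsto_const_nhds.congr' ?_
      filter_upwards [(hp s hs0).eventually_lt_const (show 2 * s < c / 4 by rw [hs]; linarith),
        hNt.eventually_gt_atTop 0] with t ht htN
      rw [indicator_of_notMem]
      intro hX
      exact absurd (le_Fpc_of_stripCount_ne_zero htN hX) (not_le.2 ht)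
  simp only [integral_zero, integral_indicator_one (hms _)] at hlim
  set m := c * s / 2 with hm
  have hm0 : 0 < m := by positivity
  have hlow : ∀ᶠ t in atTop, m / (1 + m) ≤ volume.real {p | X t p ≠ 0} := by
    filter_upwards [hE, hNt.eventually_gt_atTop 0, hreal.eventually_ge_atTop (2 / c),
      hreal.eventually_ge_atTop (2 * s)] with t h1 h2 h3 h4
    have hN' : (0 : ℝ) < Nt t := by exact_mod_cast h2
    have hcard := le_card_popularDiffs hA h2 hc (by rwa [div_le_iff₀' hc] at h3) h1
    refine le_trans ?_ (measureReal_stripCount_ne_zero (by positivity) _)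
    have hmin : min 1 (2 * (s / Nt t)) = 2 * (s / Nt t) := by
      refine min_eq_right ?_
      rw [← mul_div_assoc]
      exact div_le_one_of_le₀ h4 hN'.le
    rw [hmin]
    have hle : m ≤ (popularDiffs A (Nt t) (c / 4)).card * (2 * (s / Nt t)) := by
      calc m = c / 4 * Nt t * (2 * (s / Nt t)) := by rw [hm]; field_simp; norm_num
        _ ≤ _ := by gcongr
    rw [div_le_div_iff₀ (by positivity) (by positivity)]
    nlinarith
  have := ge_of_tendsto hlim hlow
  have : 0 < m / (1 + m) := by positivity
  linarith

lemma integral_Fpc_sub_mean_sq_le {A : Set ℕ} (hA : A.Infinite) {s : ℝ} (hs : 0 < s) (N : ℕ) :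
    ∫ p : 𝕋 × 𝕋, (Fpc p.1 p.2 s N A -
      (Finset.range N).offDiag.card * min 1 (2 * (s / N)) / N) ^ 2 ≤
      2 * s * (addE (firstN A N) / (N : ℝ) ^ 3) := by
  have hρ : 0 ≤ s / N := by positivity
  simp_rw [Fpc_eq_stripCount, ← sub_div, div_pow, integral_div]
  rw [integral_stripCount_sub_mean_sq _ _ hρ]
  have h1 : (collisions (Finset.range N).offDiag (enumDiff A) : ℝ) ≤ addE (firstN A N) := by
    exact_mod_cast collisions_le_addE hA N
  have h2 : min 1 (2 * (s / N)) - min 1 (2 * (s / N)) ^ 2 ≤ 2 * (s / N) := by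
    nlinarith [min_le_right 1 (2 * (s / N)), sq_nonneg (min 1 (2 * (s / N)))]
  calc _ ≤ addE (firstN A N) * (2 * (s / N)) / (N : ℝ) ^ 2 := by
        gcongr
        have : 0 ≤ min 1 (2 * (s / N)) := by positivity
        nlinarith [min_le_left 1 (2 * (s / N))]
    _ = _ := by
        rcases Nat.eq_zero_or_pos N with rfl | hN
        · simp
        · field_simp

lemma tendsto_mean_Fpc {Nt : ℕ → ℕ} (hNt : Tendsto Nt atTop atTop) (s : ℝ) :
    Tendsto (fun t => ((Finset.range (Nt t)).offDiag.card * min 1 (2 * (s / Nt t)) / Nt t : ℝ))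
      atTop (nhds (2 * s)) := by
  have hreal : Tendsto (fun t => (Nt t : ℝ)) atTop atTop :=
    tendsto_natCast_atTop_atTop.comp hNt
  have hlim : Tendsto (fun t => 2 * s - 2 * s / (Nt t : ℝ)) atTop (nhds (2 * s - 0)) :=
    tendsto_const_nhds.sub (hreal.const_div_atTop _)
  rw [sub_zero] at hlim
  refine hlim.congr' ?_
  filter_upwards [hNt.eventually_gt_atTop 0, hreal.eventually_ge_atTop (2 * s)] with t h2 h4
  have hN' : (0 : ℝ) < Nt t := by exact_mod_cast h2
  have hmin : min 1 (2 * (s / Nt t)) = 2 * (s / Nt t) := by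
    refine min_eq_right ?_
    rw [← mul_div_assoc]
    exact div_le_one_of_le₀ h4 hN'.le
  rw [hmin, Finset.offDiag_card, Finset.card_range,
    Nat.cast_sub (Nat.le_mul_of_pos_left _ h2)]
  push_cast
  field_simp

/-- A sequence of functions whose square integrals are summable tends to zero almost everywhere. -/
lemma ae_tendsto_zero_of_integral_sq_le {Ω : Type*} [MeasurableSpace Ω] {μ : Measure Ω}
    {g : ℕ → Ω → ℝ} (hg : ∀ t, Measurable (g t)) (hi : ∀ t, Integrable (fun x => g t x ^ 2) μ)
    {b : ℕ → ℝ} (hb : Summable b) (hle : ∀ t, ∫ x, g t x ^ 2 ∂μ ≤ b t) :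
    ∀ᵐ x ∂μ, Tendsto (fun t => g t x) atTop (nhds 0) := by
  have hmeas : ∀ t, Measurable fun x => ENNReal.ofReal (g t x ^ 2) := fun t =>
    ((hg t).pow_const 2).ennreal_ofReal
  have hfin : ∫⁻ x, ∑' t, ENNReal.ofReal (g t x ^ 2) ∂μ ≠ ⊤ := by
    rw [lintegral_tsum fun t => (hmeas t).aemeasurable]
    refine ne_top_of_le_ne_top hb.tsum_ofReal_ne_top (ENNReal.tsum_le_tsum fun t => ?_)
    rw [← ofReal_integral_eq_lintegral_ofReal (hi t) (Eventually.of_forall fun x => sq_nonneg _)]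
    exact ENNReal.ofReal_le_ofReal (hle t)
  filter_upwards [ae_lt_top (Measurable.tsum hmeas) hfin] with x hx
  have h0 := ENNReal.tendsto_atTop_zero_of_tsum_ne_top hx.ne
  have h1 := (ENNReal.tendsto_toReal ENNReal.zero_ne_top).comp h0
  have h2 : Tendsto (fun t => g t x ^ 2) atTop (nhds 0) := by
    refine h1.congr fun t => ?_
    simp [ENNReal.toReal_ofReal (sq_nonneg _)]
  have h3 := h2.sqrt
  simp only [Real.sqrt_sq_eq_abs, Real.sqrt_zero] at h3
  exact (tendsto_zero_iff_abs_tendsto_zero _).2 h3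

lemma Fpc_mono (A : Set ℕ) (p : 𝕋 × 𝕋) (N : ℕ) : Monotone fun s => Fpc p.1 p.2 s N A := by
  intro s s' h
  simp only [Fpc_eq_stripCount, stripCount]
  refine div_le_div_of_nonneg_right (Finset.sum_le_sum fun x _ => ?_) (Nat.cast_nonneg N)
  have hsub : strip (s / N) (enumDiff A x) ⊆ strip (s' / N) (enumDiff A x) := fun q hq =>
    le_trans (b := s / N) hq (by gcongr)
  exact indicator_le_indicator_of_subset (f := (1 : 𝕋 × 𝕋 → ℝ)) hsub (fun _ => zero_le_one) p

/-- Summable normalized energies imply Poissonian pair correlations. -/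
lemma DMPPCAlong_of_summable {A : Set ℕ} (hA : A.Infinite) {Nt : ℕ → ℕ}
    (hNt : Tendsto Nt atTop atTop)
    (hE : Summable fun t => (addE (firstN A (Nt t)) : ℝ) / (Nt t : ℝ) ^ 3) :
    DMPPCAlong A Nt := by
  have hfix : ∀ s : ℝ, 0 < s → ∀ᵐ p : 𝕋 × 𝕋,
      Tendsto (fun t => Fpc p.1 p.2 s (Nt t) A) atTop (nhds (2 * s)) := by
    intro s hs
    have hmain := ae_tendsto_zero_of_integral_sq_le (μ := (volume : Measure (𝕋 × 𝕋)))
      (g := fun t p => Fpc p.1 p.2 s (Nt t) A -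
        (Finset.range (Nt t)).offDiag.card * min 1 (2 * (s / Nt t)) / Nt t) ?_ ?_
      (hE.mul_left (2 * s)) (fun t => integral_Fpc_sub_mean_sq_le hA hs (Nt t))
    · filter_upwards [hmain] with p hp
      simpa using hp.add (tendsto_mean_Fpc hNt s)
    · intro t
      simp_rw [Fpc_eq_stripCount]
      exact ((measurable_stripCount _ _ _).div_const _).sub_const _
    · intro t
      simp_rw [Fpc_eq_stripCount, sub_sq, div_pow]
      refine (((integrable_stripCount_sq _ _ _).div_const _).sub ?_).add (integrable_const _)
      exact (((integrable_stripCount _ _ _).div_const _).const_mul _).mul_const _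
  have hrat : ∀ᵐ p : 𝕋 × 𝕋, ∀ r : ℚ, 0 < (r : ℝ) →
      Tendsto (fun t => Fpc p.1 p.2 r (Nt t) A) atTop (nhds (2 * (r : ℝ))) := by
    rw [ae_all_iff]
    intro r
    by_cases hr : 0 < (r : ℝ)
    · filter_upwards [hfix r hr] with p hp _ using hp
    · exact Eventually.of_forall fun p h => absurd h hr
  filter_upwards [hrat] with p hp s hs
  refine tendsto_order.2 ⟨fun a ha => ?_, fun a ha => ?_⟩
  · obtain ⟨r, hr1, hr2⟩ := exists_rat_btwn (max_lt hs (show a / 2 < s by linarith))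
    have hr0 := (le_max_left _ _).trans_lt hr1
    have hra := (le_max_right _ _).trans_lt hr1
    filter_upwards [(hp r hr0).eventually_const_lt (show a < 2 * (r : ℝ) by linarith)] with t ht
    exact ht.trans_le (Fpc_mono A p (Nt t) hr2.le)
  · obtain ⟨r, hr1, hr2⟩ := exists_rat_btwn (show s < a / 2 by linarith)
    filter_upwards [(hp r (hs.trans hr1)).eventually_lt_const
      (show 2 * (r : ℝ) < a by linarith)] with t ht
    exact (Fpc_mono A p (Nt t) hr1.le).trans_lt ht

lemma addE_div_le {A : Set ℕ} (hA : A.Infinite) (N : ℕ) :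
    (addE (firstN A N) : ℝ) / (N : ℝ) ^ 3 ≤ 2 := by
  rcases Nat.eq_zero_or_pos N with rfl | hN
  · simp
  have h1 := addE_le_collisions_add hA N
  have h2 : collisions (Finset.range N).offDiag (enumDiff A) ≤ N ^ 2 * N := by
    rw [collisions_eq_sum_diffCount]
    refine (Finset.sum_le_card_nsmul _ _ N fun x _ => diffCount_le hA N _).trans ?_
    rw [smul_eq_mul, Finset.offDiag_card, Finset.card_range, sq]
    gcongr
    exact Nat.sub_le _ _
  have h3 : N ^ 2 ≤ N ^ 2 * N := Nat.le_mul_of_pos_right _ hN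
  have h4 : addE (firstN A N) ≤ 2 * N ^ 3 := by
    rw [pow_succ N 2]
    lia
  rw [div_le_iff₀ (by positivity)]
  exact_mod_cast h4

/-- A bounded nonnegative sequence has lower limit zero iff it is frequently small. -/
lemma liminf_eq_zero_iff_frequently_lt {u : ℕ → ℝ} (h0 : ∀ n, 0 ≤ u n) {b : ℝ}
    (hb : ∀ n, u n ≤ b) :
    liminf u atTop = 0 ↔ ∀ ε > 0, ∃ᶠ n in atTop, u n < ε := by
  have hbdd : IsBoundedUnder (· ≥ ·) atTop u := isBoundedUnder_of ⟨0, h0⟩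
  have hcob : IsCoboundedUnder (· ≥ ·) atTop u :=
    (isBoundedUnder_of (r := (· ≤ ·)) ⟨b, hb⟩).isCoboundedUnder_ge
  constructor
  · intro h ε hε
    exact frequently_lt_of_liminf_lt hcob (h ▸ hε)
  · intro h
    refine le_antisymm (le_of_forall_pos_le_add fun ε hε => ?_)
      (le_liminf_of_le hcob (Eventually.of_forall h0))
    rw [zero_add]
    exact liminf_le_of_frequently_le ((h ε hε).mono fun _ => le_of_lt) hbdd

/-- **Theorem.** For an infinite `A ⊆ ℕ`, there exists a strictly increasing integer sequence
along which `A` has doubly metric Poissonian pair correlations iff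
`liminf_{N→∞} N⁻³·E(A_N) = 0`. -/
theorem stmt_4 (A : Set ℕ) (hA : A.Infinite) :
    (∃ Nt : ℕ → ℕ, StrictMono Nt ∧ DMPPCAlong A Nt) ↔
      Filter.liminf (fun N : ℕ => (addE (firstN A N) : ℝ) / (N : ℝ) ^ 3) atTop = 0 := by
  rw [liminf_eq_zero_iff_frequently_lt (fun N => by positivity) (addE_div_le hA)]
  constructor
  · rintro ⟨Nt, hmono, hD⟩ c hc
    by_contra hcon
    rw [not_frequently] at hcon
    refine not_DMPPCAlong_of_le_addE hA hmono.tendsto_atTop hc ?_ hD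
    filter_upwards [hmono.tendsto_atTop.eventually hcon,
      hmono.tendsto_atTop.eventually_gt_atTop 0] with t ht ht0
    have : (0 : ℝ) < Nt t := by exact_mod_cast ht0
    exact (le_div_iff₀ (by positivity)).1 (not_lt.1 ht)
  · intro h
    obtain ⟨Nt, hmono, hNt⟩ := extraction_forall_of_frequently
      (P := fun t N => (addE (firstN A N) : ℝ) / (N : ℝ) ^ 3 < (1 / 2 : ℝ) ^ t)
      fun t => h _ (by positivity)
    refine ⟨Nt, hmono, DMPPCAlong_of_summable hA hmono.tendsto_atTop ?_⟩
    exact Summable.of_nonneg_of_le (fun t => by positivity) (fun t => (hNt t).le)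
      summable_geometric_two
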